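/- (Domination of left multiplication by the Jordan multiplication.) Let a, b ∈ M_n(ℂ) be positive semidefinite with a ≤ b (Loewner order). Then for every y ∈ M_n(ℂ): ‖a^{1/2} y‖_2 ≤ ‖b^{1/2} y + y b^{1/2}‖_2, where ‖·‖_2 is the Frobenius norm and a^{1/2}, b^{1/2} are the positive semidefinite square roots. -/

import Mathlib

open scoped BigOperators
open Matrix MeasureTheory
open scoped ComplexOrder

/-- `A^β` for a Hermitian (in practice positive semidefinite) matrix `A`, via the
spectral functional calculus (with the conventions of `Real.rpow` on eigenvalues,
in particular `0 ^ β = 0` for `β ≠ 0`), extended by `0` to non-Hermitian matrices. -/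
noncomputable def posPow {ι : Type*} [Fintype ι] [DecidableEq ι]
    (A : Matrix ι ι ℂ) (β : ℝ) : Matrix ι ι ℂ :=
  if hA : A.IsHermitian then hA.cfc (fun t => t ^ β) else 0

/-- Schatten `p`-(quasi)norm of a complex matrix: `(Tr((A*A)^(p/2)))^(1/p)`. -/
noncomputable def schattenNorm {ι : Type*} [Fintype ι] [DecidableEq ι]
    (p : ℝ) (A : Matrix ι ι ℂ) : ℝ :=
  ((posPow (Aᴴ * A) (p / 2)).trace.re) ^ (1 / p)

/-- Operator norm of a matrix, acting on the Euclidean space. -/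
noncomputable def opNorm {ι : Type*} [Fintype ι] [DecidableEq ι]
    (A : Matrix ι ι ℂ) : ℝ :=
  ‖Matrix.toEuclideanCLM (𝕜 := ℂ) A‖

/-- The quantity `|||x|||_p` for `0 < p ≤ 2`: the infimum of
`‖(∑ aₖ*aₖ)^(1/2)‖_p + ‖(∑ bₖbₖ*)^(1/2)‖_p` over decompositions `xₖ = aₖ + bₖ`. -/
noncomputable def tripleNorm {n N : ℕ} (p : ℝ)
    (x : Fin N → Matrix (Fin n) (Fin n) ℂ) : ℝ :=
  sInf { r : ℝ | ∃ a b : Fin N → Matrix (Fin n) (Fin n) ℂ,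
    (∀ k, x k = a k + b k) ∧
    r = schattenNorm p (posPow (∑ k, (a k)ᴴ * a k) (1/2))
        + schattenNorm p (posPow (∑ k, b k * (b k)ᴴ) (1/2)) }

/-- `E_ε ‖∑ ε_k x_k‖_p ^ p`, the average over a uniformly random choice of signs. -/
noncomputable def radAvg {n N : ℕ} (p : ℝ)
    (x : Fin N → Matrix (Fin n) (Fin n) ℂ) : ℝ :=
  (1 / 2 ^ N) * ∑ ε : Fin N → Bool,
    (schattenNorm p (∑ k, (if ε k then (1 : ℂ) else -1) • x k)) ^ p

lemma posPow_one {ι : Type*} [Fintype ι] [DecidableEq ι] {A : Matrix ι ι ℂ}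
    (hA : A.IsHermitian) : posPow A 1 = A := by
  rw [posPow, dif_pos hA]
  conv_rhs => rw [hA.spectral_theorem]
  simp only [IsHermitian.cfc, Function.comp_def, Real.rpow_one]

lemma posPow_isHermitian {ι : Type*} [Fintype ι] [DecidableEq ι] (A : Matrix ι ι ℂ) (β : ℝ) :
    (posPow A β).IsHermitian := by
  unfold posPow
  split_ifs with hA
  · rw [← hA.cfc_eq]
    exact cfc_predicate (fun t : ℝ => t ^ β) A
  · exact isHermitian_zero

lemma posPow_mul_posPow {ι : Type*} [Fintype ι] [DecidableEq ι] {A : Matrix ι ι ℂ}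
    (hA : A.PosSemidef) {β γ : ℝ} (hβ : 0 ≤ β) (hγ : 0 ≤ γ) :
    posPow A β * posPow A γ = posPow A (β + γ) := by
  simp only [posPow, dif_pos hA.1, IsHermitian.cfc]
  rw [← map_mul, diagonal_mul_diagonal]
  congr 2
  funext i
  simp [Real.rpow_add_of_nonneg (hA.eigenvalues_nonneg i) hβ hγ]

lemma posPow_half_mul_self {ι : Type*} [Fintype ι] [DecidableEq ι] {A : Matrix ι ι ℂ}
    (hA : A.PosSemidef) : posPow A (1 / 2) * posPow A (1 / 2) = A := by
  rw [posPow_mul_posPow hA (by norm_num) (by norm_num), add_halves, posPow_one hA.1]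

lemma schattenNorm_two {ι : Type*} [Fintype ι] [DecidableEq ι] (A : Matrix ι ι ℂ) :
    schattenNorm 2 A = √(Aᴴ * A).trace.re := by
  rw [schattenNorm, div_self two_ne_zero, posPow_one (isHermitian_conjTranspose_mul_self A),
    Real.sqrt_eq_rpow]

lemma Matrix.PosSemidef.re_trace_nonneg {ι : Type*} [Fintype ι] {A : Matrix ι ι ℂ}
    (hA : A.PosSemidef) : 0 ≤ A.trace.re :=
  (Complex.le_def.mp hA.trace_nonneg).1

/-- The cross term of the Jordan product by a square `r * r` is a squared Frobenius norm. -/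
lemma trace_conjTranspose_mul_sq_mul_mul_sq {ι : Type*} [Fintype ι] {r : Matrix ι ι ℂ}
    (hr : r.IsHermitian) (y : Matrix ι ι ℂ) :
    (yᴴ * (r * r) * y * (r * r)).trace = ((r * y * r)ᴴ * (r * y * r)).trace := by
  rw [← mul_assoc, trace_mul_comm]
  simp only [conjTranspose_mul, hr.eq, mul_assoc]

lemma trace_jordan_mul {ι : Type*} [Fintype ι] {t : Matrix ι ι ℂ}
    (ht : t.IsHermitian) (y : Matrix ι ι ℂ) :
    ((t * y + y * t)ᴴ * (t * y + y * t)).trace =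
      (yᴴ * (t * t) * y).trace + ((y * t)ᴴ * (y * t)).trace + 2 * (yᴴ * t * y * t).trace := by
  have h : (t * (yᴴ * (t * y))).trace = (yᴴ * (t * (y * t))).trace := by
    rw [trace_mul_comm]
    simp only [mul_assoc]
  simp only [conjTranspose_add, conjTranspose_mul, ht.eq, add_mul, mul_add, trace_add, mul_assoc, h]
  ring

/-- Domination of left multiplication by the Jordan multiplication:
if `0 ≤ a ≤ b` then `‖a^(1/2) y‖₂ ≤ ‖b^(1/2) y + y b^(1/2)‖₂`. -/
theorem statement15 (n : ℕ) (a b : Matrix (Fin n) (Fin n) ℂ)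
    (ha : a.PosSemidef) (hb : b.PosSemidef) (hab : (b - a).PosSemidef)
    (y : Matrix (Fin n) (Fin n) ℂ) :
    schattenNorm 2 (posPow a (1/2) * y) ≤
      schattenNorm 2 (posPow b (1/2) * y + y * posPow b (1/2)) := by
  have hq := trace_conjTranspose_mul_sq_mul_mul_sq (posPow_isHermitian b (1 / 4)) y
  rw [posPow_mul_posPow hb (by norm_num) (by norm_num),
    show (1 / 4 + 1 / 4 : ℝ) = 1 / 2 by norm_num] at hq
  have hl : (posPow a (1 / 2) * y)ᴴ * (posPow a (1 / 2) * y) = yᴴ * a * y := by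
    rw [conjTranspose_mul, (posPow_isHermitian a _).eq, mul_assoc, ← mul_assoc (posPow a _),
      posPow_half_mul_self ha, mul_assoc]
  rw [schattenNorm_two, schattenNorm_two, hl, trace_jordan_mul (posPow_isHermitian b _), hq,
    posPow_half_mul_self hb]
  apply Real.sqrt_le_sqrt
  have h₁ := (hab.conjTranspose_mul_mul_same y).re_trace_nonneg
  have h₂ := (posSemidef_conjTranspose_mul_self (y * posPow b (1 / 2))).re_trace_nonneg
  have h₃ := (posSemidef_conjTranspose_mul_self
    (posPow b (1 / 4) * y * posPow b (1 / 4))).re_trace_nonneg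
  rw [mul_sub, sub_mul, trace_sub, Complex.sub_re] at h₁
  simp only [Complex.add_re, Complex.mul_re, Complex.re_ofNat, Complex.im_ofNat, zero_mul,
    sub_zero]
  linarith
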